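/- For all a < b, μ > 0 and R > 0 there exists a constant C > 0, depending only on a, b, μ and R, with the following property: for every T > 0, every ν ≥ 0, and every smooth solution (u, θ) of the regularized thermoelasticity system on [0,T] with θ ≥ 0 and with ‖u₁‖_{L²} ≤ R, ‖(u₀)_x‖_{L²} ≤ R and ∫_a^b θ₀ ≤ R, one has for every t ∈ [0,T]: ‖θ(t)‖_{L²}² + ∫₀ᵗ ‖θ_x(s)‖_{L²}² ds ≤ e^{C t} ‖θ₀‖_{L²}². -/

import Mathlib

open Set MeasureTheory

/-- Partial derivative in the first (time) variable. -/
noncomputable def pt (w : ℝ → ℝ → ℝ) (t x : ℝ) : ℝ := deriv (fun s => w s x) t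

/-- Partial derivative in the second (space) variable. -/
noncomputable def px (w : ℝ → ℝ → ℝ) (t x : ℝ) : ℝ := deriv (fun y => w t y) x

/-- Square of the L² norm on (a,b). -/
noncomputable def sqInt (a b : ℝ) (f : ℝ → ℝ) : ℝ := ∫ x in a..b, (f x) ^ 2

/-- The L² norm on (a,b). -/
noncomputable def L2norm (a b : ℝ) (f : ℝ → ℝ) : ℝ := Real.sqrt (sqInt a b f)

/-- A smooth solution of the regularized thermoelasticity system on [0,T] × [a,b]:
`u_tt − u_xx − ν u_txx = −μ θ_x`, `θ_t − θ_xx + μ θ u_tx = 0`,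
with Dirichlet boundary conditions for `u` and Neumann boundary conditions for `θ`. -/
def IsRegSolution (a b μ T ν : ℝ) (u θ : ℝ → ℝ → ℝ) : Prop :=
  ContDiff ℝ (⊤ : ℕ∞) (Function.uncurry u) ∧ ContDiff ℝ (⊤ : ℕ∞) (Function.uncurry θ) ∧
  (∀ t ∈ Set.Icc (0:ℝ) T, ∀ x ∈ Set.Icc a b,
      pt (pt u) t x - px (px u) t x - ν * px (px (pt u)) t x = -μ * px θ t x) ∧
  (∀ t ∈ Set.Icc (0:ℝ) T, ∀ x ∈ Set.Icc a b,
      pt θ t x - px (px θ) t x + μ * θ t x * px (pt u) t x = 0) ∧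
  (∀ t ∈ Set.Icc (0:ℝ) T, u t a = 0 ∧ u t b = 0) ∧
  (∀ t ∈ Set.Icc (0:ℝ) T, px θ t a = 0 ∧ px θ t b = 0)

section PartialDerivatives

variable {w : ℝ → ℝ → ℝ}

lemma hasDerivAt_fst_fderiv (hw : ContDiff ℝ (⊤ : ℕ∞) (Function.uncurry w)) (t x : ℝ) :
    HasDerivAt (fun s => w s x) (fderiv ℝ (Function.uncurry w) (t, x) (1, 0)) t := by
  have h := (hw.differentiable (by simp) (t, x)).hasFDerivAt
  exact h.comp_hasDerivAt t ((hasDerivAt_id t).prodMk (hasDerivAt_const t x))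

lemma hasDerivAt_snd_fderiv (hw : ContDiff ℝ (⊤ : ℕ∞) (Function.uncurry w)) (t x : ℝ) :
    HasDerivAt (fun y => w t y) (fderiv ℝ (Function.uncurry w) (t, x) (0, 1)) x := by
  have h := (hw.differentiable (by simp) (t, x)).hasFDerivAt
  exact h.comp_hasDerivAt x ((hasDerivAt_const x t).prodMk (hasDerivAt_id x))

lemma pt_eq_fderiv (hw : ContDiff ℝ (⊤ : ℕ∞) (Function.uncurry w)) :
    Function.uncurry (pt w) = fun p => fderiv ℝ (Function.uncurry w) p (1, 0) :=
  funext fun p => (hasDerivAt_fst_fderiv hw p.1 p.2).deriv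

lemma px_eq_fderiv (hw : ContDiff ℝ (⊤ : ℕ∞) (Function.uncurry w)) :
    Function.uncurry (px w) = fun p => fderiv ℝ (Function.uncurry w) p (0, 1) :=
  funext fun p => (hasDerivAt_snd_fderiv hw p.1 p.2).deriv

lemma hasDerivAt_pt (hw : ContDiff ℝ (⊤ : ℕ∞) (Function.uncurry w)) (t x : ℝ) :
    HasDerivAt (fun s => w s x) (pt w t x) t :=
  (hasDerivAt_fst_fderiv hw t x).differentiableAt.hasDerivAt

lemma hasDerivAt_px (hw : ContDiff ℝ (⊤ : ℕ∞) (Function.uncurry w)) (t x : ℝ) :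
    HasDerivAt (fun y => w t y) (px w t x) x :=
  (hasDerivAt_snd_fderiv hw t x).differentiableAt.hasDerivAt

lemma contDiff_pt (hw : ContDiff ℝ (⊤ : ℕ∞) (Function.uncurry w)) :
    ContDiff ℝ (⊤ : ℕ∞) (Function.uncurry (pt w)) := by
  rw [pt_eq_fderiv hw]
  exact (hw.fderiv_right (m := (⊤ : ℕ∞)) (by simp)).clm_apply contDiff_const

lemma contDiff_px (hw : ContDiff ℝ (⊤ : ℕ∞) (Function.uncurry w)) :
    ContDiff ℝ (⊤ : ℕ∞) (Function.uncurry (px w)) := by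
  rw [px_eq_fderiv hw]
  exact (hw.fderiv_right (m := (⊤ : ℕ∞)) (by simp)).clm_apply contDiff_const

/-- Mixed partial derivatives of a smooth function commute. -/
lemma pt_px_comm (hw : ContDiff ℝ (⊤ : ℕ∞) (Function.uncurry w)) (t x : ℝ) :
    pt (px w) t x = px (pt w) t x := by
  have hd : Differentiable ℝ (fderiv ℝ (Function.uncurry w)) :=
    (hw.fderiv_right (m := (⊤ : ℕ∞)) (by simp)).differentiable (by simp)
  have h1 := (hasDerivAt_fst_fderiv (contDiff_px hw) t x).deriv
  have h2 := (hasDerivAt_snd_fderiv (contDiff_pt hw) t x).deriv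
  have hs : IsSymmSndFDerivAt ℝ (Function.uncurry w) (t, x) :=
    hw.contDiffAt.isSymmSndFDerivAt (by
      rw [minSmoothness_of_isRCLikeNormedField]
      exact WithTop.coe_le_coe.2 le_top)
  have hd' (v : ℝ × ℝ) : fderiv ℝ (fun p => fderiv ℝ (Function.uncurry w) p v) (t, x) =
      (fderiv ℝ (fderiv ℝ (Function.uncurry w)) (t, x)).flip v := by
    rw [fderiv_clm_apply (hd _) (by fun_prop)]
    simp
  rw [px_eq_fderiv hw, hd'] at h1
  rw [pt_eq_fderiv hw, hd'] at h2
  exact h1.trans ((hs _ _).trans h2.symm)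

end PartialDerivatives

/-- Differentiation under the integral sign over a compact interval. -/
lemma hasDerivAt_intervalIntegral_of_continuous {G G' : ℝ → ℝ → ℝ} (a b : ℝ)
    (hG : Continuous (Function.uncurry G)) (hG' : Continuous (Function.uncurry G'))
    (hd : ∀ t x, HasDerivAt (fun s => G s x) (G' t x) t) (t : ℝ) :
    HasDerivAt (fun s => ∫ x in a..b, G s x) (∫ x in a..b, G' t x) t := by
  obtain ⟨M, hM⟩ := ((isCompact_Icc (a := t - 1) (b := t + 1)).prod
    (isCompact_uIcc (a := a) (b := b))).exists_bound_of_continuousOn hG'.continuousOn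
  refine (intervalIntegral.hasDerivAt_integral_of_dominated_loc_of_deriv_le
    (bound := fun _ => M) (Icc_mem_nhds (by linarith : t - 1 < t) (by linarith : t < t + 1))
    (Filter.Eventually.of_forall fun s => ?_) ?_ ?_ ?_ ?_ ?_).2
  · exact (by fun_prop : Continuous (G s)).aestronglyMeasurable
  · exact (by fun_prop : Continuous (G t)).intervalIntegrable _ _
  · exact (by fun_prop : Continuous (G' t)).aestronglyMeasurable
  · exact Filter.Eventually.of_forall fun x hx s hs => hM (s, x) ⟨hs, uIoc_subset_uIcc hx⟩
  · exact intervalIntegrable_const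
  · exact Filter.Eventually.of_forall fun x _ s _ => hd s x

/-- Integrals of functions that differ by an exact derivative with equal boundary values agree. -/
lemma integral_eq_of_eq_add_deriv {a b : ℝ} {f h q q' : ℝ → ℝ} (hab : a ≤ b)
    (hh : Continuous h) (hq' : Continuous q') (hq : ∀ x, HasDerivAt q (q' x) x)
    (hqab : q a = q b) (hf : ∀ x ∈ Icc a b, f x = h x + q' x) :
    ∫ x in a..b, f x = ∫ x in a..b, h x := by
  rw [intervalIntegral.integral_congr (g := fun x => h x + q' x)
      (fun x hx => hf x (by rwa [uIcc_of_le hab] at hx)),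
    intervalIntegral.integral_add (hh.intervalIntegrable _ _) (hq'.intervalIntegrable _ _),
    intervalIntegral.integral_eq_sub_of_hasDerivAt (fun x _ => hq x) (hq'.intervalIntegrable _ _),
    hqab, sub_self, add_zero]

/-- Agmon's inequality on a bounded interval, with a small constant in front of the derivative. -/
lemma agmon_sq_le {a b ε : ℝ} {f f' : ℝ → ℝ} (hab : a < b) (hε : 0 < ε)
    (hf' : Continuous f') (hf : ∀ x, HasDerivAt f (f' x) x) {x : ℝ} (hx : x ∈ Icc a b) :
    f x ^ 2 ≤ ((b - a)⁻¹ + ε⁻¹) * (∫ y in a..b, f y ^ 2) + ε * ∫ y in a..b, f' y ^ 2 := by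
  have hfc : Continuous f := continuous_iff_continuousAt.2 fun y => (hf y).continuousAt
  set B := ∫ y in a..b, (ε⁻¹ * f y ^ 2 + ε * f' y ^ 2) with hB
  have hBc : Continuous fun y => ε⁻¹ * f y ^ 2 + ε * f' y ^ 2 := by fun_prop
  have hB0 : 0 ≤ᵐ[volume.restrict (Ioc a b)] fun y => ε⁻¹ * f y ^ 2 + ε * f' y ^ 2 :=
    Filter.Eventually.of_forall fun y => by simp only [Pi.zero_apply]; positivity
  have hBeq : B = ε⁻¹ * (∫ y in a..b, f y ^ 2) + ε * ∫ y in a..b, f' y ^ 2 := by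
    rw [hB, intervalIntegral.integral_add
      ((by fun_prop : Continuous _).intervalIntegrable _ _)
      ((by fun_prop : Continuous _).intervalIntegrable _ _),
      intervalIntegral.integral_const_mul, intervalIntegral.integral_const_mul]
  have hpt : ∀ y, |2 * f y * f' y| ≤ ε⁻¹ * f y ^ 2 + ε * f' y ^ 2 := fun y => by
    have e1 : ε⁻¹ * (f y + ε * f' y) ^ 2 = ε⁻¹ * f y ^ 2 + ε * f' y ^ 2 + 2 * f y * f' y := by
      field_simp; ring
    have e2 : ε⁻¹ * (f y - ε * f' y) ^ 2 = ε⁻¹ * f y ^ 2 + ε * f' y ^ 2 - 2 * f y * f' y := by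
      field_simp; ring
    have p1 : 0 ≤ ε⁻¹ * (f y + ε * f' y) ^ 2 := by positivity
    have p2 : 0 ≤ ε⁻¹ * (f y - ε * f' y) ^ 2 := by positivity
    exact abs_le.2 ⟨by linarith, by linarith⟩
  have hdiff : ∀ y ∈ Icc a b, f x ^ 2 ≤ f y ^ 2 + B := fun y hy => by
    have hint : ∫ z in y..x, 2 * f z * f' z = f x ^ 2 - f y ^ 2 :=
      intervalIntegral.integral_eq_sub_of_hasDerivAt (f := fun z => f z ^ 2)
        (fun z _ => by simpa using (hf z).fun_pow 2)
        ((by fun_prop : Continuous _).intervalIntegrable _ _)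
    have h1 : |∫ z in y..x, 2 * f z * f' z| ≤ B := by
      calc |∫ z in y..x, 2 * f z * f' z|
          ≤ |∫ z in y..x, (ε⁻¹ * f z ^ 2 + ε * f' z ^ 2)| :=
            intervalIntegral.norm_integral_le_abs_of_norm_le (μ := volume)
              (f := fun z => 2 * f z * f' z) (Filter.Eventually.of_forall hpt) (hBc.intervalIntegrable y x)
        _ ≤ |B| := by
            refine intervalIntegral.abs_integral_mono_interval ?_ ?_ (hBc.intervalIntegrable _ _)
            · rw [uIoc_of_le hab.le]
              exact Ioc_subset_Ioc (le_min hy.1 hx.1) (max_le hy.2 hx.2)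
            · rwa [uIoc_of_le hab.le]
        _ = B := abs_of_nonneg (intervalIntegral.integral_nonneg hab.le fun y _ => by positivity)
    have := (abs_le.1 h1).2
    linarith
  have hmono : ∫ _ in a..b, f x ^ 2 ≤ ∫ y in a..b, (f y ^ 2 + B) :=
    intervalIntegral.integral_mono_on hab.le intervalIntegrable_const
      ((by fun_prop : Continuous _).intervalIntegrable _ _) hdiff
  rw [intervalIntegral.integral_add ((by fun_prop : Continuous _).intervalIntegrable _ _)
    intervalIntegrable_const] at hmono
  simp only [intervalIntegral.integral_const, smul_eq_mul] at hmono
  have hL : 0 < b - a := sub_pos.2 hab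
  have hdiv : f x ^ 2 ≤ (b - a)⁻¹ * (∫ y in a..b, f y ^ 2) + B := by
    rw [← mul_le_mul_iff_right₀ hL, mul_add, mul_inv_cancel_left₀ hL.ne']
    exact hmono
  rw [hBeq] at hdiv
  linarith

section RegSolution

variable {a b μ T ν : ℝ} {u θ : ℝ → ℝ → ℝ}

lemma pt_eq_zero_of_eq_zero {c : ℝ} (h : ∀ t ∈ Icc (0 : ℝ) T, u t c = 0) {t : ℝ}
    (ht : t ∈ Ioo 0 T) : pt u t c = 0 := by
  have : (fun s => u s c) =ᶠ[nhds t] fun _ => 0 := by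
    filter_upwards [isOpen_Ioo.mem_nhds ht] with s hs using h s (Ioo_subset_Icc_self hs)
  simp [pt, this.deriv_eq]

/-- The total energy (twice the mechanical energy plus twice the heat) is nonincreasing. -/
lemma IsRegSolution.energy_antitoneOn (hab : a ≤ b) (hν : 0 ≤ ν)
    (h : IsRegSolution a b μ T ν u θ) :
    AntitoneOn (fun t => ∫ x in a..b, (pt u t x ^ 2 + px u t x ^ 2 + 2 * θ t x)) (Icc 0 T) := by
  obtain ⟨hu, hθ, hwave, hheat, hdir, hneu⟩ := h
  have cθ := hθ.continuous
  have cut := (contDiff_pt hu).continuous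
  have cux := (contDiff_px hu).continuous
  have cutt := (contDiff_pt (contDiff_pt hu)).continuous
  have cuxt := (contDiff_pt (contDiff_px hu)).continuous
  have cuxx := (contDiff_px (contDiff_px hu)).continuous
  have cutx := (contDiff_px (contDiff_pt hu)).continuous
  have cutxx := (contDiff_px (contDiff_px (contDiff_pt hu))).continuous
  have cθt := (contDiff_pt hθ).continuous
  have cθx := (contDiff_px hθ).continuous
  have cθxx := (contDiff_px (contDiff_px hθ)).continuous
  have hd : ∀ t, HasDerivAt
      (fun t => ∫ x in a..b, (pt u t x ^ 2 + px u t x ^ 2 + 2 * θ t x))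
      (∫ x in a..b, (2 * pt u t x * pt (pt u) t x + 2 * px u t x * pt (px u) t x
        + 2 * pt θ t x)) t := by
    refine hasDerivAt_intervalIntegral_of_continuous a b
      (G := fun t x => pt u t x ^ 2 + px u t x ^ 2 + 2 * θ t x)
      (G' := fun t x => 2 * pt u t x * pt (pt u) t x + 2 * px u t x * pt (px u) t x
        + 2 * pt θ t x) (by fun_prop) (by fun_prop) fun t x => ?_
    have h1 : HasDerivAt (fun s => pt u s x ^ 2) (2 * pt u t x * pt (pt u) t x) t := by
      simpa using (hasDerivAt_pt (contDiff_pt hu) t x).fun_pow 2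
    have h2 : HasDerivAt (fun s => px u s x ^ 2) (2 * px u t x * pt (px u) t x) t := by
      simpa using (hasDerivAt_pt (contDiff_px hu) t x).fun_pow 2
    exact (h1.add h2).add ((hasDerivAt_pt hθ t x).const_mul 2)
  refine antitoneOn_of_deriv_nonpos (convex_Icc _ _)
    (fun t _ => (hd t).continuousAt.continuousWithinAt)
    (fun t _ => (hd t).differentiableAt.differentiableWithinAt) fun t ht => ?_
  rw [interior_Icc] at ht
  have ht' := Ioo_subset_Icc_self ht
  have hua := pt_eq_zero_of_eq_zero (fun s hs => (hdir s hs).1) ht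
  have hub := pt_eq_zero_of_eq_zero (fun s hs => (hdir s hs).2) ht
  rw [(hd t).deriv, integral_eq_of_eq_add_deriv (h := fun x => -(2 * ν * px (pt u) t x ^ 2))
    (q := fun x => 2 * (pt u t x * (px u t x + ν * px (pt u) t x - μ * θ t x)) + 2 * px θ t x)
    (q' := fun x => 2 * (px (pt u) t x * (px u t x + ν * px (pt u) t x - μ * θ t x)
      + pt u t x * (px (px u) t x + ν * px (px (pt u)) t x - μ * px θ t x))
      + 2 * px (px θ) t x) hab (by fun_prop) (by fun_prop)]
  · rw [intervalIntegral.integral_neg, neg_nonpos]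
    exact intervalIntegral.integral_nonneg hab fun x _ => by positivity
  · intro x
    have h1 := hasDerivAt_px (contDiff_pt hu) t x
    have h2 := hasDerivAt_px (contDiff_px hu) t x
    have h3 := (hasDerivAt_px (contDiff_px (contDiff_pt hu)) t x).const_mul ν
    have h4 := (hasDerivAt_px hθ t x).const_mul μ
    have h5 := (hasDerivAt_px (contDiff_px hθ) t x).const_mul 2
    exact ((h1.mul ((h2.add h3).sub h4)).const_mul 2).add h5
  · simp [hua, hub, hneu t ht']
  · intro x hx
    have e1 := hwave t ht' x hx
    have e2 := hheat t ht' x hx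
    rw [pt_px_comm hu]
    linear_combination 2 * pt u t x * e1 + 2 * e2

/-- The velocity stays bounded in `L²` by the initial energy. -/
lemma IsRegSolution.sqInt_velocity_le {R : ℝ} (hab : a ≤ b) (hν : 0 ≤ ν)
    (hR : 0 ≤ R) (h : IsRegSolution a b μ T ν u θ)
    (hpos : ∀ t ∈ Icc (0 : ℝ) T, ∀ x ∈ Icc a b, 0 ≤ θ t x)
    (hu₁ : L2norm a b (fun x => pt u 0 x) ≤ R) (hu₀ : L2norm a b (fun x => px u 0 x) ≤ R)
    (hθ₀ : (∫ x in a..b, θ 0 x) ≤ R) {t : ℝ} (ht : t ∈ Icc 0 T) :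
    (∫ x in a..b, pt u t x ^ 2) ≤ 2 * R ^ 2 + 2 * R := by
  have hE := h.energy_antitoneOn hab hν ⟨le_rfl, ht.1.trans ht.2⟩ ht ht.1
  have cut := (contDiff_pt h.1).continuous
  have cux := (contDiff_px h.1).continuous
  have cθ := h.2.1.continuous
  have hlow : (∫ x in a..b, pt u t x ^ 2) ≤
      ∫ x in a..b, (pt u t x ^ 2 + px u t x ^ 2 + 2 * θ t x) :=
    intervalIntegral.integral_mono_on hab (Continuous.intervalIntegrable (by fun_prop) _ _)
      (Continuous.intervalIntegrable (by fun_prop) _ _) fun x hx => by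
        have := hpos t ht x hx
        nlinarith [sq_nonneg (px u t x)]
  have hsplit : (∫ x in a..b, (pt u 0 x ^ 2 + px u 0 x ^ 2 + 2 * θ 0 x)) =
      sqInt a b (fun x => pt u 0 x) + sqInt a b (fun x => px u 0 x)
        + 2 * ∫ x in a..b, θ 0 x := by
    rw [intervalIntegral.integral_add (Continuous.intervalIntegrable (by fun_prop) _ _)
      (Continuous.intervalIntegrable (by fun_prop) _ _),
      intervalIntegral.integral_add (Continuous.intervalIntegrable (by fun_prop) _ _)
      (Continuous.intervalIntegrable (by fun_prop) _ _), intervalIntegral.integral_const_mul]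
    rfl
  have h1 := (Real.sqrt_le_left hR).1 hu₁
  have h0 := (Real.sqrt_le_left hR).1 hu₀
  simp only at hE
  linarith

/-- The `L²` energy identity for the temperature. -/
lemma IsRegSolution.hasDerivAt_sqInt_temperature (hab : a ≤ b)
    (h : IsRegSolution a b μ T ν u θ) {t : ℝ} (ht : t ∈ Ioo 0 T) :
    HasDerivAt (fun t => ∫ x in a..b, θ t x ^ 2)
      (∫ x in a..b, (-(2 * px θ t x ^ 2) + 4 * μ * (θ t x * px θ t x * pt u t x))) t := by
  obtain ⟨hu, hθ, -, hheat, hdir, hneu⟩ := h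
  have cθ := hθ.continuous
  have cut := (contDiff_pt hu).continuous
  have cutx := (contDiff_px (contDiff_pt hu)).continuous
  have cθt := (contDiff_pt hθ).continuous
  have cθx := (contDiff_px hθ).continuous
  have cθxx := (contDiff_px (contDiff_px hθ)).continuous
  have ht' := Ioo_subset_Icc_self ht
  have hua := pt_eq_zero_of_eq_zero (fun s hs => (hdir s hs).1) ht
  have hub := pt_eq_zero_of_eq_zero (fun s hs => (hdir s hs).2) ht
  convert hasDerivAt_intervalIntegral_of_continuous a b (G := fun t x => θ t x ^ 2)
      (G' := fun t x => 2 * θ t x * pt θ t x) (by fun_prop) (by fun_prop) (fun t x => ?_) t using 1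
  · refine (integral_eq_of_eq_add_deriv
      (q := fun x => 2 * (θ t x * px θ t x) - 2 * μ * (θ t x ^ 2 * pt u t x))
      (q' := fun x => 2 * (px θ t x * px θ t x + θ t x * px (px θ) t x)
        - 2 * μ * (2 * θ t x * px θ t x * pt u t x + θ t x ^ 2 * px (pt u) t x))
      hab (by fun_prop) (by fun_prop) (fun x => ?_) ?_ fun x hx => ?_).symm
    · have h1 := hasDerivAt_px hθ t x
      have h2 := hasDerivAt_px (contDiff_px hθ) t x
      have h3 := hasDerivAt_px (contDiff_pt hu) t x
      have h4 : HasDerivAt (fun y => θ t y ^ 2) (2 * θ t x * px θ t x) x := by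
        simpa using h1.fun_pow 2
      exact ((h1.mul h2).const_mul 2).sub ((h4.mul h3).const_mul (2 * μ))
    · simp [hua, hub, hneu t ht']
    · linear_combination 2 * θ t x * hheat t ht' x hx
  · simpa using (hasDerivAt_pt hθ t x).fun_pow 2

end RegSolution

/-- The coupling term is absorbed by the dissipation, up to a multiple of the `L²` norm. -/
lemma coupling_integral_le {a b μ K : ℝ} {f f' v : ℝ → ℝ} (hab : a < b) (hμ : 0 < μ)
    (hK : 0 < K) (hf' : Continuous f') (hf : ∀ x, HasDerivAt f (f' x) x) (hv : Continuous v)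
    (hvK : (∫ x in a..b, v x ^ 2) ≤ K) :
    (∫ x in a..b, (-(2 * f' x ^ 2) + 4 * μ * (f x * f' x * v x))) + (∫ x in a..b, f' x ^ 2) ≤
      8 * μ ^ 2 * K * ((b - a)⁻¹ + 16 * μ ^ 2 * K) * ∫ x in a..b, f x ^ 2 := by
  have hfc : Continuous f := continuous_iff_continuousAt.2 fun y => (hf y).continuousAt
  set N := ∫ x in a..b, f x ^ 2 with hN
  set D := ∫ x in a..b, f' x ^ 2 with hD
  set M := ((b - a)⁻¹ + 16 * μ ^ 2 * K) * N + (16 * μ ^ 2 * K)⁻¹ * D with hM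
  have hN0 : 0 ≤ N := intervalIntegral.integral_nonneg hab.le fun x _ => by positivity
  have hD0 : 0 ≤ D := intervalIntegral.integral_nonneg hab.le fun x _ => by positivity
  have hL : 0 < b - a := sub_pos.2 hab
  have hM0 : 0 ≤ M := by positivity
  have hsup : ∀ x ∈ Icc a b, f x ^ 2 ≤ M := fun x hx => by
    have := agmon_sq_le hab (ε := (16 * μ ^ 2 * K)⁻¹) (by positivity) hf' hf hx
    rwa [inv_inv] at this
  have hle : (∫ x in a..b, (-(2 * f' x ^ 2) + 4 * μ * (f x * f' x * v x))) ≤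
      ∫ x in a..b, (-(3 / 2) * f' x ^ 2 + 8 * μ ^ 2 * M * v x ^ 2) :=
    intervalIntegral.integral_mono_on hab.le (Continuous.intervalIntegrable (by fun_prop) _ _)
      (Continuous.intervalIntegrable (by fun_prop) _ _) fun x hx => by
        have h1 : 8 * μ ^ 2 * v x ^ 2 * f x ^ 2 ≤ 8 * μ ^ 2 * v x ^ 2 * M :=
          mul_le_mul_of_nonneg_left (hsup x hx) (by positivity)
        nlinarith [sq_nonneg (f' x - 4 * μ * (f x * v x))]
  rw [intervalIntegral.integral_add (f := fun x => -(3 / 2) * f' x ^ 2)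
    (Continuous.intervalIntegrable (by fun_prop) _ _)
    (Continuous.intervalIntegrable (by fun_prop) _ _), intervalIntegral.integral_const_mul,
    intervalIntegral.integral_const_mul, ← hD] at hle
  have hMK : 8 * μ ^ 2 * M * (∫ x in a..b, v x ^ 2) ≤ 8 * μ ^ 2 * M * K :=
    mul_le_mul_of_nonneg_left hvK (by positivity)
  have hMe : 8 * μ ^ 2 * M * K =
      8 * μ ^ 2 * K * ((b - a)⁻¹ + 16 * μ ^ 2 * K) * N + 1 / 2 * D := by
    rw [hM]
    field_simp
    ring
  linarith

/-- An integrated Grönwall inequality with a dissipation term. -/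
lemma gronwall_with_dissipation {C T : ℝ} {N N' D : ℝ → ℝ} (hC : 0 ≤ C)
    (hNc : Continuous N) (hDc : Continuous D) (hD : ∀ t, 0 ≤ D t)
    (hN : ∀ t ∈ Ioo 0 T, HasDerivAt N (N' t) t) (hle : ∀ t ∈ Ioo 0 T, N' t + D t ≤ C * N t)
    {t : ℝ} (ht : t ∈ Icc 0 T) :
    N t + (∫ s in (0 : ℝ)..t, D s) ≤ Real.exp (C * t) * N 0 := by
  have hI : ∀ t, HasDerivAt (fun t => ∫ s in (0 : ℝ)..t, D s) (D t) t := fun t =>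
    intervalIntegral.integral_hasDerivAt_right (hDc.intervalIntegrable _ _)
      hDc.aestronglyMeasurable.stronglyMeasurableAtFilter hDc.continuousAt
  have hIc : Continuous (fun t => ∫ s in (0 : ℝ)..t, D s) :=
    continuous_iff_continuousAt.2 fun t => (hI t).continuousAt
  have hd : ∀ t ∈ Ioo 0 T, HasDerivAt
      (fun t => Real.exp (-(C * t)) * (N t + ∫ s in (0 : ℝ)..t, D s))
      (Real.exp (-(C * t)) * -(C * 1) * (N t + ∫ s in (0 : ℝ)..t, D s)
        + Real.exp (-(C * t)) * (N' t + D t)) t := fun t ht =>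
    (((hasDerivAt_id t).const_mul C).neg.exp).mul ((hN t ht).add (hI t))
  have hanti : AntitoneOn (fun t => Real.exp (-(C * t)) * (N t + ∫ s in (0 : ℝ)..t, D s))
      (Icc 0 T) := by
    refine antitoneOn_of_deriv_nonpos (convex_Icc _ _) (by fun_prop) ?_ ?_ <;>
      rw [interior_Icc]
    · exact fun t ht => (hd t ht).differentiableAt.differentiableWithinAt
    · intro t ht
      rw [(hd t ht).deriv]
      have h0 : 0 ≤ C * ∫ s in (0 : ℝ)..t, D s :=
        mul_nonneg hC (intervalIntegral.integral_nonneg ht.1.le fun s _ => hD s)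
      have h1 := mul_nonneg (Real.exp_pos (-(C * t))).le
        (by linarith [hle t ht] : 0 ≤ C * (N t + ∫ s in (0 : ℝ)..t, D s) - (N' t + D t))
      linarith
  have h := hanti ⟨le_rfl, ht.1.trans ht.2⟩ ht ht.1
  simp only [mul_zero, neg_zero, Real.exp_zero, one_mul, intervalIntegral.integral_same,
    add_zero] at h
  have hexp := mul_le_mul_of_nonneg_left h (Real.exp_pos (C * t)).le
  rwa [← mul_assoc, ← Real.exp_add, add_neg_cancel, Real.exp_zero, one_mul] at hexp

/-- **Time-independent second first-order estimate.** For all `a < b`, `μ > 0`, `R > 0` there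
is a constant `C > 0` depending only on `a, b, μ, R` such that any nonnegative smooth solution
of the regularized system (any `T > 0`, any `ν ≥ 0`) with `‖u₁‖ ≤ R`, `‖(u₀)_x‖ ≤ R` and
`∫ θ₀ ≤ R` satisfies `‖θ(t)‖² + ∫₀ᵗ ‖θ_x‖² ≤ e^{Ct} ‖θ₀‖²` for every `t ∈ [0,T]`. -/
theorem theta_L2_estimate (a b μ R : ℝ) (hab : a < b) (hμ : 0 < μ) (hR : 0 < R) :
    ∃ C > 0, ∀ T > (0:ℝ), ∀ ν ≥ (0:ℝ), ∀ u θ : ℝ → ℝ → ℝ,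
      IsRegSolution a b μ T ν u θ →
      (∀ t ∈ Icc (0:ℝ) T, ∀ x ∈ Icc a b, 0 ≤ θ t x) →
      L2norm a b (fun x => pt u 0 x) ≤ R →
      L2norm a b (fun x => px u 0 x) ≤ R →
      (∫ x in a..b, θ 0 x) ≤ R →
      ∀ t ∈ Icc (0:ℝ) T,
        sqInt a b (fun x => θ t x) + (∫ s in (0:ℝ)..t, sqInt a b (fun x => px θ s x))
          ≤ Real.exp (C * t) * sqInt a b (fun x => θ 0 x) := by
  have hK : 0 < 2 * R ^ 2 + 2 * R := by positivity
  have hL : 0 < b - a := sub_pos.2 hab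
  set K := 2 * R ^ 2 + 2 * R
  refine ⟨8 * μ ^ 2 * K * ((b - a)⁻¹ + 16 * μ ^ 2 * K), by positivity, ?_⟩
  intro T _ ν hν u θ h hpos hu₁ hu₀ hθ₀ t ht
  have cθ := h.2.1.continuous
  have cut := (contDiff_pt h.1).continuous
  have cθx := (contDiff_px h.2.1).continuous
  exact gronwall_with_dissipation (by positivity)
    (intervalIntegral.continuous_parametric_intervalIntegral_of_continuous'
      (f := fun t x => θ t x ^ 2) (by fun_prop) a b)
    (intervalIntegral.continuous_parametric_intervalIntegral_of_continuous'
      (f := fun t x => px θ t x ^ 2) (by fun_prop) a b)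
    (fun s => intervalIntegral.integral_nonneg hab.le fun x _ => sq_nonneg _)
    (fun s hs => h.hasDerivAt_sqInt_temperature hab.le hs)
    (fun s hs => coupling_integral_le hab hμ hK (by fun_prop) (hasDerivAt_px h.2.1 s)
      (by fun_prop) (h.sqInt_velocity_le hab.le hν hR.le hpos hu₁ hu₀ hθ₀
        (Ioo_subset_Icc_self hs))) ht
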